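/- Let N̂ be an independent set of points in a projective geometry P and let Ê ⊆ Ê^•(N̂). Then the class of balanced circles of the constructed graph is a linear class, so Ω(N̂, Ê) is a biased graph, and the natural correspondence e ↦ ê is a matroid isomorphism from the frame matroid G(Ω(N̂, Ê)) onto the matroid M(Ê) of projective dependence of Ê. -/

import Mathlib

open scoped Classical

/-! ## Graphs with parallel links and half edges -/

/-- A multigraph: each edge has a finite set of endpoints
(one endpoint for a half edge, two endpoints for a link). -/
structure MGraph (N : Type*) (E : Type*) where
  ends : E → Finset N

namespace MGraph

variable {N E : Type*} (G : MGraph N E)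

/-- A link has two distinct endpoints. -/
def IsLink (e : E) : Prop := (G.ends e).card = 2

/-- A half edge has exactly one endpoint. -/
def IsHalfEdge (e : E) : Prop := (G.ends e).card = 1

/-- The set of nodes of a set of edges. -/
def nodeSet (S : Set E) : Set N := {v | ∃ e ∈ S, v ∈ G.ends e}

/-- The nodes of a finite set of edges. -/
noncomputable def nodesOf (S : Finset E) : Finset N := S.biUnion G.ends

/-- The degree of a node in a finite edge set. -/
noncomputable def degreeIn (S : Finset E) (v : N) : ℕ :=
  (S.filter (fun e => v ∈ G.ends e)).card

/-- Two nodes joined by an edge of `S`. -/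
def adjIn (S : Set E) (u v : N) : Prop := ∃ e ∈ S, u ∈ G.ends e ∧ v ∈ G.ends e

/-- Connectivity of nodes through edges of `S`. -/
def nodeConn (S : Set E) : N → N → Prop := Relation.ReflTransGen (G.adjIn S)

/-- The components of the spanning subgraph `(N, S)`, as sets of nodes. -/
def components (S : Set E) : Set (Set N) := {W | ∃ v : N, W = {u | G.nodeConn S u v}}

/-- The number of components of the spanning subgraph `(N, S)`. -/
noncomputable def numComponents (S : Set E) : ℕ := Nat.card ↥(G.components S)

/-- The components of the non-spanning subgraph `(N(S), S)`. -/
def componentsOn (S : Set E) : Set (Set N) :=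
  {W | ∃ v ∈ G.nodeSet S, W = {u | G.nodeConn S u v}}

/-- The edges of `S` whose endpoints all lie in a node set `W`. -/
def edgesIn (S : Set E) (W : Set N) : Set E := {e | e ∈ S ∧ ∀ v ∈ G.ends e, v ∈ W}

/-- An edge set is connected if any two of its edges are joined through
consecutively intersecting edges of the set. -/
def ConnEdges (S : Set E) : Prop :=
  ∀ e ∈ S, ∀ f ∈ S, Relation.ReflTransGen
    (fun a b => a ∈ S ∧ b ∈ S ∧ ∃ v : N, v ∈ G.ends a ∧ v ∈ G.ends b) e f

/-- A circle: the edge set of a connected subgraph in which every node has degree 2. -/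
def IsCircle (C : Finset E) : Prop :=
  C.Nonempty ∧ (∀ e ∈ C, G.IsLink e) ∧ G.ConnEdges ↑C ∧
    ∀ v ∈ G.nodesOf C, G.degreeIn C v = 2

/-- A (simple, open) path joining two distinct nodes `u` and `v`. -/
def IsPath (Q : Finset E) (u v : N) : Prop :=
  Q.Nonempty ∧ u ≠ v ∧ (∀ e ∈ Q, G.IsLink e) ∧ G.ConnEdges ↑Q ∧
    u ∈ G.nodesOf Q ∧ v ∈ G.nodesOf Q ∧
    G.degreeIn Q u = 1 ∧ G.degreeIn Q v = 1 ∧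
    ∀ w ∈ G.nodesOf Q, w ≠ u → w ≠ v → G.degreeIn Q w = 2

/-- A simple graph: all edges are links and no two edges have the same endpoints. -/
def IsSimple : Prop := (∀ e : E, G.IsLink e) ∧ Function.Injective G.ends

/-- The graph is connected. -/
def IsConnected : Prop := ∀ u v : N, G.nodeConn Set.univ u v

/-- Inseparable graph: connected, and for every partition of the edge set into two
nonempty parts the two parts share at least two nodes. -/
def IsInseparable : Prop :=
  G.IsConnected ∧ ∀ A B : Set E, A.Nonempty → B.Nonempty → Disjoint A B →
    A ∪ B = Set.univ → ∃ u v : N, u ≠ v ∧ u ∈ G.nodeSet A ∧ u ∈ G.nodeSet B ∧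
      v ∈ G.nodeSet A ∧ v ∈ G.nodeSet B

/-- A linear class of circles: every member is a circle and no theta subgraph (the
union of three pairwise internally disjoint paths with the same two endpoints)
contains exactly two members of the class. -/
def IsLinearClass (B : Set (Finset E)) : Prop :=
  (∀ C ∈ B, G.IsCircle C) ∧
  ∀ u v : N, ∀ P₁ P₂ P₃ : Finset E,
    G.IsPath P₁ u v → G.IsPath P₂ u v → G.IsPath P₃ u v →
    Disjoint P₁ P₂ → Disjoint P₁ P₃ → Disjoint P₂ P₃ →
    (↑(G.nodesOf P₁) ∩ ↑(G.nodesOf P₂) : Set N) = {u, v} →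
    (↑(G.nodesOf P₁) ∩ ↑(G.nodesOf P₃) : Set N) = {u, v} →
    (↑(G.nodesOf P₂) ∩ ↑(G.nodesOf P₃) : Set N) = {u, v} →
    P₁ ∪ P₂ ∈ B → P₁ ∪ P₃ ∈ B → P₂ ∪ P₃ ∈ B

/-- A balanced edge set with respect to a class `B` of balanced circles:
no half edges, and every circle inside it belongs to `B`. -/
def IsBalancedSet (B : Set (Finset E)) (S : Set E) : Prop :=
  (∀ e ∈ S, G.IsLink e) ∧ ∀ C : Finset E, ↑C ⊆ S → G.IsCircle C → C ∈ B

/-- The number of balanced components of the spanning subgraph `(N, S)`. -/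
noncomputable def numBalComponents (B : Set (Finset E)) (S : Set E) : ℕ :=
  Nat.card ↥{W : Set N | W ∈ G.components S ∧ G.IsBalancedSet B (G.edgesIn S W)}

/-- Frame matroid rank function: `rk S = #N - b(S)`. -/
noncomputable def frameRk [Fintype N] (B : Set (Finset E)) (S : Set E) : ℕ :=
  Fintype.card N - G.numBalComponents B S

/-- Graphic (cycle) matroid rank function: `rk S = #N - c(S)`. -/
noncomputable def graphicRk [Fintype N] (S : Set E) : ℕ :=
  Fintype.card N - G.numComponents S

/-- Graphic matroid rank of a finite edge set, computed inside its own node set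
(valid also for infinite graphs): `rk S = #N(S) - c(N(S), S)`. -/
noncomputable def graphicRkOn (S : Finset E) : ℕ :=
  (G.nodesOf S).card - Nat.card ↥(G.componentsOn ↑S)

/-- Extended lift matroid rank function on `E ⊕ Unit`, where `Sum.inr ()` is the
extra point `e₀`: `rk S = #N - c(S ∩ E)` if `S ⊆ E` is balanced, and
`#N - c(S ∩ E) + 1` if `S` is unbalanced or contains `e₀`. -/
noncomputable def liftRk [Fintype N] (B : Set (Finset E)) (S : Set (E ⊕ Unit)) : ℕ :=
  if G.IsBalancedSet B {e | Sum.inl e ∈ S} ∧ Sum.inr () ∉ S then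
    Fintype.card N - G.numComponents {e | Sum.inl e ∈ S}
  else Fintype.card N - G.numComponents {e | Sum.inl e ∈ S} + 1

/-- Closed sets of the frame matroid (via the rank function; the matroid is finitary). -/
def FrameClosed [Fintype N] (B : Set (Finset E)) (S : Set E) : Prop :=
  ∀ e : E, (∃ S₀ : Finset E, ↑S₀ ⊆ S ∧
    G.frameRk B ↑(insert e S₀) = G.frameRk B ↑S₀) → e ∈ S

/-- Closed sets of the extended lift matroid. -/
def LiftClosed [Fintype N] (B : Set (Finset E)) (S : Set (E ⊕ Unit)) : Prop :=
  ∀ x : E ⊕ Unit, (∃ S₀ : Finset (E ⊕ Unit), ↑S₀ ⊆ S ∧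
    G.liftRk B ↑(insert x S₀) = G.liftRk B ↑S₀) → x ∈ S

/-- The balance-closure of an edge set. -/
def bcl (B : Set (Finset E)) (S : Set E) : Set E :=
  S ∪ {e | ∃ C ∈ B, e ∈ C ∧ ↑C ⊆ S ∪ {e}}

/-- The subgraph of all links, as a graph on the same nodes. -/
def linkGraph : MGraph N {e : E // G.IsLink e} := ⟨fun e => G.ends e.val⟩

/-- Restriction of a class of circles to the subgraph of links. -/
def linkBal (B : Set (Finset E)) : Set (Finset {e : E // G.IsLink e}) :=
  {C | C.image Subtype.val ∈ B}

/-- The subgraph on a subset of the edges (spanning all nodes). -/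
def sub (D : Set E) : MGraph N ↥D := ⟨fun f => G.ends f.val⟩

end MGraph

/-- A graph together with a distinguished class of "balanced" circles.
(It is a biased graph when the class is a linear class.) -/
structure BiasedGraph (N E : Type*) extends MGraph N E where
  Bal : Set (Finset E)

/-- The complete graph on a node set `N`. -/
def completeMGraph (N : Type*) : MGraph N {q : Finset N // q.card = 2} := ⟨Subtype.val⟩

/-- A gain graph with gain group `Γ`: each edge is given by a source, a target
(equal for a half edge) and a gain in the direction from source to target. -/
structure GainGraph (N E : Type*) (Γ : Type*) [Group Γ] extends MGraph N E where
  src : E → N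
  tgt : E → N
  gain : E → Γ
  ends_eq : ∀ e : E, ends e = {src e, tgt e}

namespace GainGraph

variable {N E Γ : Type*} [Group Γ] (Φ : GainGraph N E Γ)

/-- The gain of an edge in the direction from `u` to `v`. -/
noncomputable def ogain (e : E) (u v : N) : Γ :=
  if Φ.src e = u ∧ Φ.tgt e = v then Φ.gain e else (Φ.gain e)⁻¹

/-- A balanced circle of a gain graph: a circle whose gain function is given by a
potential on the nodes (equivalently, the product of its gains along a cyclic
orientation is the identity). -/
def BalancedCircle (C : Finset E) : Prop :=
  Φ.toMGraph.IsCircle C ∧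
    ∃ θ : N → Γ, ∀ e ∈ C, Φ.gain e = (θ (Φ.src e))⁻¹ * θ (Φ.tgt e)

/-- The biased graph `⟨Φ⟩` of a gain graph. -/
def biasedGraph : BiasedGraph N E := { Φ.toMGraph with Bal := {C | Φ.BalancedCircle C} }

end GainGraph

/-- A biased expansion of a graph `Δ` along a projection `p`: `p` is surjective,
preserves endpoints, and every circle of `Δ` with a chosen lift of all but one of
its edges has a unique completion to a balanced circle. -/
def IsBiasedExpansion {N E E' : Type*} (G : MGraph N E) (B : Set (Finset E))
    (Δ : MGraph N E') (p : E → E') : Prop :=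
  Function.Surjective p ∧ (∀ e : E, G.ends e = Δ.ends (p e)) ∧
  ∀ C : Finset E', Δ.IsCircle C → ∀ e₀ ∈ C, ∀ s : E' → E,
    (∀ f ∈ C.erase e₀, p (s f) = f) →
    ∃! t : E, p t = e₀ ∧ (C.erase e₀).image s ∪ {t} ∈ B

/-! ## Axiomatic (synthetic) projective geometry -/

/-- An axiomatic projective geometry: a point set with a line through any two
points, unique when the points are distinct, every line having at least three
points, and satisfying the Veblen–Young axiom. -/
structure ProjGeom (P : Type*) where
  line : P → P → Set P
  line_self : ∀ p : P, line p p = {p}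
  line_symm : ∀ p q : P, line p q = line q p
  left_mem_line : ∀ p q : P, p ∈ line p q
  right_mem_line : ∀ p q : P, q ∈ line p q
  line_unique : ∀ p q x y : P, p ≠ q → x ∈ line p q → y ∈ line p q → x ≠ y →
    line x y = line p q
  exists_third : ∀ p q : P, p ≠ q → ∃ r ∈ line p q, r ≠ p ∧ r ≠ q
  veblen : ∀ p q r s x : P, p ≠ q → r ≠ s → p ≠ r → q ≠ s →
    x ∈ line p q → x ∈ line r s → ∃ y, y ∈ line p r ∧ y ∈ line q s

namespace ProjGeom

variable {P : Type*} (G : ProjGeom P)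

/-- A flat (subspace): a line-closed set of points. -/
def IsFlat (t : Set P) : Prop := ∀ p ∈ t, ∀ q ∈ t, G.line p q ⊆ t

/-- The span of a point set: the smallest flat containing it. -/
def span (A : Set P) : Set P := ⋂₀ {t : Set P | G.IsFlat t ∧ A ⊆ t}

/-- An independent point set: no point is in the span of the others. -/
def Indep (A : Set P) : Prop := ∀ a ∈ A, a ∉ G.span (A \ {a})

/-- The (matroid) rank of a point set: the largest cardinality of a finite
independent subset. -/
noncomputable def rank (A : Set P) : ℕ :=
  sSup {n : ℕ | ∃ B : Finset P, ↑B ⊆ A ∧ G.Indep ↑B ∧ B.card = n}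

/-- A hyperplane: a maximal proper flat. -/
def IsHyperplane (h : Set P) : Prop :=
  G.IsFlat h ∧ h ≠ Set.univ ∧ ∀ t : Set P, G.IsFlat t → h ⊆ t → t = h ∨ t = Set.univ

/-- The codimension of a flat: the least number of hyperplanes intersecting in it. -/
noncomputable def codim (t : Set P) : ℕ :=
  sInf {n : ℕ | ∃ H : Finset (Set P), H.card = n ∧ (∀ h ∈ H, G.IsHyperplane h) ∧
    ⋂₀ ↑H = t}

variable {N : Type*}

/-- A cross-flat with respect to an independent family `ν`: a flat containing
none of the points `ν v`. -/
def crossFlat (ν : N → P) (t : Set P) : Prop := G.IsFlat t ∧ ∀ v : N, ν v ∉ t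

/-- The union of all edge lines of the independent family `ν`. -/
def edgeLineUnion (ν : N → P) : Set P :=
  ⋃ (v : N) (w : N) (_ : v ≠ w), G.line (ν v) (ν w)

/-! ### The Menelaean (point) construction for the frame matroid -/

/-- The underlying graph of the Menelaean construction `Ω(N̂, Ehat)`: a point of `Ehat`
in `N̂` is a half edge, any other point is a link joining the ends of its edge line. -/
noncomputable def menGraph (ν : N → P) (Ehat : Set P)
    (hE : ∀ x ∈ Ehat, x ∉ Set.range ν →
      ∃ pr : N × N, pr.1 ≠ pr.2 ∧ x ∈ G.line (ν pr.1) (ν pr.2)) :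
    MGraph N ↥Ehat where
  ends e :=
    if h : (e : P) ∈ Set.range ν then {(show ∃ v : N, ν v = ↑e from h).choose}
    else {(hE e e.2 h).choose.1, (hE e e.2 h).choose.2}

/-- The balanced circles of the Menelaean construction: circles whose point set
lies in a cross-flat. -/
noncomputable def menBal (ν : N → P) (Ehat : Set P)
    (hE : ∀ x ∈ Ehat, x ∉ Set.range ν →
      ∃ pr : N × N, pr.1 ≠ pr.2 ∧ x ∈ G.line (ν pr.1) (ν pr.2)) :
    Set (Finset ↥Ehat) :=
  {C | (G.menGraph ν Ehat hE).IsCircle C ∧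
    ∃ t : Set P, G.crossFlat ν t ∧ ∀ e ∈ C, (e : P) ∈ t}

/-! ### The Cevian (hyperplane) construction for the frame matroid -/

/-- A Cevian arrangement over the point basis `ν`, described by its associated
graph `Γ` and its apex function: a link `e` with endpoints `v, w` has its apex on
the edge line `v̂ŵ`, off the basis; a half edge at `v` has apex `ν v`. -/
def IsCevian {E : Type*} (ν : N → P) (Γ : MGraph N E) (apex : E → P) : Prop :=
  ∀ e : E,
    (∃ v w : N, v ≠ w ∧ Γ.ends e = ({v, w} : Finset N) ∧
      apex e ∈ G.line (ν v) (ν w) ∧ apex e ∉ Set.range ν) ∨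
    (∃ v : N, Γ.ends e = ({v} : Finset N) ∧ apex e = ν v)

/-- The apical hyperplane of an edge of a Cevian arrangement. -/
def cevHyp {E : Type*} (ν : N → P) (Γ : MGraph N E) (apex : E → P) (e : E) : Set P :=
  if Γ.IsLink e then G.span ((ν '' {u : N | u ∉ Γ.ends e}) ∪ {apex e})
  else G.span (ν '' {u : N | u ∉ Γ.ends e})

/-- The rank function of a Cevian arrangement:
the codimension of the intersection of the corresponding apical hyperplanes. -/
noncomputable def cevRk {E : Type*} (ν : N → P) (Γ : MGraph N E) (apex : E → P)
    (S : Finset E) : ℕ :=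
  G.codim (⋂ e ∈ S, G.cevHyp ν Γ apex e)

/-- The balanced circles of a Cevian arrangement:
circles of deficient hyperplane-intersection rank. -/
noncomputable def cevBal {E : Type*} (ν : N → P) (Γ : MGraph N E) (apex : E → P) :
    Set (Finset E) :=
  {C | Γ.IsCircle C ∧ G.cevRk ν Γ apex C < C.card}

/-! ### The orthographic (point) construction for the lift matroid -/

/-- The projection of the orthographic construction: each point of `Ehat` lies on the
edge line `z'(f)e₀` of a unique edge `f` of `Δ`. -/
noncomputable def orthoProj {E' : Type*} (z' : E' → P) (e₀ : P) (Ehat : Set P)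
    (hE : ∀ x ∈ Ehat, ∃ f : E', x ∈ G.line (z' f) e₀) : ↥Ehat → E' :=
  fun e => (hE e e.2).choose

/-- The underlying graph of the orthographic construction `Ω₀(Ehat)`. -/
noncomputable def orthoGraph {E' : Type*} (Δ : MGraph N E') (z' : E' → P) (e₀ : P)
    (Ehat : Set P) (hE : ∀ x ∈ Ehat, ∃ f : E', x ∈ G.line (z' f) e₀) : MGraph N ↥Ehat :=
  ⟨fun e => Δ.ends (G.orthoProj z' e₀ Ehat hE e)⟩

/-- The balanced circles of the orthographic construction:
circles spanning a cross-flat (a flat not containing `e₀`). -/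
noncomputable def orthoBal {E' : Type*} (Δ : MGraph N E') (z' : E' → P) (e₀ : P)
    (Ehat : Set P) (hE : ∀ x ∈ Ehat, ∃ f : E', x ∈ G.line (z' f) e₀) : Set (Finset ↥Ehat) :=
  {C | (G.orthoGraph Δ z' e₀ Ehat hE).IsCircle C ∧
    e₀ ∉ G.span (Subtype.val '' (↑C : Set ↥Ehat))}

end ProjGeom

/-! ### Synthetic affinographic arrangements -/

/-- A synthetic affinographic arrangement of hyperplanes in the affine geometry
obtained from the projective geometry `G` by deleting the ideal hyperplane `hinf`:
a family of hyperplanes `hP e` (given by their projective completions, with affine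
parts `hP e \ hinf`), with parallel classes indexed by the edges of a graph `Δ` with
links only via the surjection `π`; hyperplanes in the class of `f` have common
ideal part `ideal f`, and the matroid of the ideal parts (rank = codimension inside
`hinf`) is the graphic matroid of `Δ`. -/
def IsAffinographic {P N E E' : Type*} [Fintype N] (G : ProjGeom P) (hinf : Set P)
    (hP : E → Set P) (Δ : MGraph N E') (π : E → E') (ideal : E' → Set P) : Prop :=
  G.IsHyperplane hinf ∧ (∀ f : E', Δ.IsLink f) ∧ Function.Surjective π ∧
  Function.Injective hP ∧ Function.Injective ideal ∧
  (∀ e : E, G.IsHyperplane (hP e) ∧ hP e ≠ hinf ∧ hP e ∩ hinf = ideal (π e)) ∧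
  ∀ S : Finset E', Δ.graphicRk (↑S : Set E') = G.codim (hinf ∩ ⋂ f ∈ S, ideal f) - 1

/-- The underlying graph of the biased graph `Ω(A)` of an affinographic
arrangement: each edge of `Δ` is replaced by the edges of its parallel class. -/
def affinoGraph {N E E' : Type*} (Δ : MGraph N E') (π : E → E') : MGraph N E :=
  ⟨fun e => Δ.ends (π e)⟩

/-- The affine intersection `t_A(S)` of the hyperplanes of `S`. -/
def affInter {P E : Type*} (hinf : Set P) (hP : E → Set P) (S : Set E) : Set P :=
  ⋂ e ∈ S, (hP e \ hinf)

/-- The balanced circles of `Ω(A)`: digons over a single edge of `Δ` are unbalanced;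
any other circle is balanced iff its affine intersection is nonempty. -/
def affinoBal {P N E E' : Type*} (_G : ProjGeom P) (hinf : Set P) (hP : E → Set P)
    (Δ : MGraph N E') (π : E → E') : Set (Finset E) :=
  {C | (affinoGraph Δ π).IsCircle C ∧ ¬(∃ f : E', ∀ e ∈ C, π e = f) ∧
    (affInter hinf hP ↑C).Nonempty}

/-! ### Coordinatized projective spaces -/

/-- The rank of a finite set of points of a coordinatized projective space:
the dimension of the linear span of representative vectors. -/
noncomputable def projRank (F : Type*) {V : Type*} [DivisionRing F] [AddCommGroup V]
    [Module F V] (A : Finset (Projectivization F V)) : ℕ :=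
  Module.finrank F ↥(Submodule.span F (Projectivization.rep '' (↑A : Set (Projectivization F V))))

/-- The edge set of the full biased graph `Ω^•`: the edges of `Ω` together with a
new half edge at every node not already supporting one. -/
def FullE {N E : Type*} (Ω : BiasedGraph N E) : Type _ :=
  E ⊕ {v : N // ∀ e : E, Ω.ends e ≠ ({v} : Finset N)}

/-- The underlying graph of the full biased graph `Ω^•`. -/
def fullGraph {N E : Type*} (Ω : BiasedGraph N E) : MGraph N (FullE Ω) :=
  ⟨Sum.elim Ω.ends (fun v => {v.val})⟩

/-- The balanced circles of the full biased graph `Ω^•` (circles avoid half edges). -/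
def fullBal {N E : Type*} (Ω : BiasedGraph N E) : Set (Finset (FullE Ω)) :=
  {C | ∃ C₀ ∈ Ω.Bal, C = C₀.image Sum.inl}

namespace ProjGeom
variable {P : Type*} (G : ProjGeom P)

theorem span_isFlat (A : Set P) : G.IsFlat (G.span A) := by
  intro p hp q hq x hx t ht
  exact ht.1 p (hp t ht) q (hq t ht) hx

theorem subset_span (A : Set P) : A ⊆ G.span A := fun _ hx _ ht => ht.2 hx

variable {G} in
theorem span_le {A t : Set P} (ht : G.IsFlat t) (h : A ⊆ t) : G.span A ⊆ t :=
  fun _ hx => hx t ⟨ht, h⟩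

variable {G} in
theorem span_le_span {A B : Set P} (h : A ⊆ G.span B) : G.span A ⊆ G.span B :=
  span_le (G.span_isFlat B) h

theorem span_mono {A B : Set P} (h : A ⊆ B) : G.span A ⊆ G.span B :=
  span_le_span (h.trans (G.subset_span B))

theorem line_eq {p q x : P} (hx : x ∈ G.line p q) (hxp : x ≠ p) : G.line x p = G.line p q := by
  by_cases h : p = q
  · subst h; rw [G.line_self] at hx; exact absurd hx hxp
  · exact G.line_unique p q x p h hx (G.left_mem_line p q) hxp

theorem line_eq' {p q x : P} (hx : x ∈ G.line p q) (hxq : x ≠ q) : G.line x q = G.line p q := by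
  rw [G.line_symm p q] at hx ⊢
  exact G.line_eq hx hxq

theorem line_sub {p q x y : P} (hx : x ∈ G.line p q) (hy : y ∈ G.line p q) :
    G.line x y ⊆ G.line p q := by
  by_cases hxy : x = y
  · subst hxy; rw [G.line_self]; simpa using hx
  by_cases h : p = q
  · subst h; rw [G.line_self] at hx hy; exact absurd (hx.trans hy.symm) hxy
  · rw [G.line_unique p q x y h hx hy hxy]

theorem join_flat {t : Set P} (ht : G.IsFlat t) {p : P} (hp : p ∉ t) :
    G.IsFlat {x | ∃ a ∈ t, x ∈ G.line a p} := by
  rintro x ⟨a, ha, hxa⟩ y ⟨b, hb, hyb⟩ z hz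
  have hap : a ≠ p := fun h => hp (h ▸ ha)
  have hbp : b ≠ p := fun h => hp (h ▸ hb)
  by_cases hbl : b ∈ G.line a p
  · refine ⟨a, ha, ?_⟩
    have h1 : y ∈ G.line a p := G.line_sub hbl (G.right_mem_line a p) hyb
    exact G.line_sub hxa h1 hz
  by_cases hxp : x = p
  · subst hxp
    exact ⟨b, hb, G.line_sub (G.right_mem_line b x) hyb hz⟩
  by_cases hyp : y = p
  · subst hyp
    exact ⟨a, ha, G.line_sub hxa (G.right_mem_line a y) hz⟩
  by_cases hzp : z = p
  · subst hzp; exact ⟨a, ha, G.right_mem_line _ _⟩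
  have hab : a ≠ b := by rintro rfl; exact hbl (G.left_mem_line _ _)
  have hxy : x ≠ y := by
    rintro rfl
    apply hbl
    rw [← G.line_eq' hxa hxp, G.line_eq' hyb hxp]
    exact G.left_mem_line _ _
  have hpx : ∀ {a x : P}, a ≠ p → x ∈ G.line a p → a ≠ x → p ∈ G.line a x := by
    intro a x hap hx hax
    rw [G.line_symm, G.line_eq hx hax.symm]
    exact G.right_mem_line _ _
  obtain ⟨d, hd1, hd2⟩ : ∃ d, d ∈ G.line a b ∧ d ∈ G.line x y := by
    by_cases h1 : a = x
    · exact ⟨a, G.left_mem_line _ _, h1 ▸ G.left_mem_line _ _⟩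
    by_cases h2 : b = y
    · exact ⟨b, G.right_mem_line _ _, h2 ▸ G.right_mem_line _ _⟩
    exact G.veblen a x b y p h1 h2 hab hxy (hpx hap hxa h1) (hpx hbp hyb h2)
  have hdt : d ∈ t := ht a ha b hb hd1
  by_cases hzd : z = d
  · exact ⟨z, hzd ▸ hdt, G.left_mem_line _ _⟩
  have hline : G.line z d = G.line x y := G.line_unique x y z d hxy hz hd2 hzd
  have fin : ∀ c ∈ t, c ∈ G.line z p → z ∈ G.line c p := by
    intro c hc hcz
    rw [G.line_eq' hcz (fun h => hp (h ▸ hc))]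
    exact G.left_mem_line _ _
  by_cases hda : d = a
  · have hdb : d ≠ b := hda ▸ hab
    obtain ⟨c, hc1, hc2⟩ := G.veblen z d p b y hzd hbp.symm hzp hdb
      (hline ▸ G.right_mem_line x y) (G.line_symm b p ▸ hyb)
    have hct : c ∈ t := ht d hdt b hb hc2
    exact ⟨c, hct, fin c hct hc1⟩
  · obtain ⟨c, hc1, hc2⟩ := G.veblen z d p a x hzd hap.symm hzp hda
      (hline ▸ G.left_mem_line x y) (G.line_symm a p ▸ hxa)
    have hct : c ∈ t := ht d hdt a ha hc2
    exact ⟨c, hct, fin c hct hc1⟩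

theorem span_empty : G.span ∅ = ∅ := by
  apply Set.subset_empty_iff.1
  exact span_le (fun p hp => by simp at hp) le_rfl

theorem span_singleton (p : P) : G.span {p} = {p} := by
  apply Set.Subset.antisymm _ (G.subset_span _)
  apply span_le _ le_rfl
  rintro a rfl b rfl
  rw [G.line_self]

variable {G} in
theorem exchange {A : Set P} {p q : P} (h : q ∈ G.span (insert p A)) (hq : q ∉ G.span A) :
    p ∈ G.span (insert q A) := by
  by_cases hpA : p ∈ G.span A
  · exact absurd (span_le_span (Set.insert_subset hpA (G.subset_span A)) h) hq
  rcases A.eq_empty_or_nonempty with rfl | ⟨a₀, ha₀⟩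
  · simp only [insert_empty_eq, span_singleton, Set.mem_singleton_iff] at *
    exact h.symm
  have : q ∈ {x | ∃ a ∈ G.span A, x ∈ G.line a p} := by
    apply span_le (G.join_flat (G.span_isFlat A) hpA) _ h
    apply Set.insert_subset
    · exact ⟨a₀, G.subset_span _ ha₀, G.right_mem_line _ _⟩
    · intro x hx
      exact ⟨x, G.subset_span _ hx, G.left_mem_line _ _⟩
  obtain ⟨a, ha, hqa⟩ := this
  have hqne : q ≠ a := fun h => hq (h ▸ ha)
  apply G.span_isFlat _ q (G.subset_span _ (Set.mem_insert _ _)) a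
    (G.span_mono (Set.subset_insert _ _) ha)
  rw [G.line_eq hqa hqne]
  exact G.right_mem_line _ _

variable {G} in
theorem span_finitary {A : Set P} {x : P} (hx : x ∈ G.span A) :
    ∃ F ⊆ A, F.Finite ∧ x ∈ G.span F := by
  have : G.span A ⊆ {x | ∃ F ⊆ A, F.Finite ∧ x ∈ G.span F} := by
    apply span_le
    · rintro p ⟨F, hF, hFf, hp⟩ q ⟨F', hF', hFf', hq⟩ z hz
      refine ⟨F ∪ F', Set.union_subset hF hF', hFf.union hFf', ?_⟩
      exact G.span_isFlat _ p (G.span_mono Set.subset_union_left hp) q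
        (G.span_mono Set.subset_union_right hq) hz
    · intro a ha
      exact ⟨{a}, by simpa using ha, Set.finite_singleton a, G.subset_span _ rfl⟩
  exact this hx

variable {G} in
theorem Indep.mono {A B : Set P} (hB : G.Indep B) (h : A ⊆ B) : G.Indep A :=
  fun a ha hs => hB a (h ha) (G.span_mono (Set.sdiff_subset_sdiff_left h) hs)

variable {G} in
theorem Indep.insert {A : Set P} {x : P} (hA : G.Indep A) (hx : x ∉ G.span A) :
    G.Indep (insert x A) := by
  have hxA : x ∉ A := fun h => hx (G.subset_span _ h)
  rintro a (rfl | ha) hs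
  · exact hx (G.span_mono (by intro y; simp; tauto) hs)
  · have hax : a ≠ x := fun h => hxA (h ▸ ha)
    have h1 : Insert.insert x A \ {a} = Insert.insert x (A \ {a}) := by
      ext y; simp; grind
    rw [h1] at hs
    have := exchange hs (hA a ha)
    apply hx
    apply G.span_mono _ this
    intro y; simp; grind

/-- the matroid of projective dependence -/
noncomputable def mat : Matroid P := (IndepMatroid.ofFinitary Set.univ G.Indep
    (by intro a ha; simp at ha)
    (fun I J hJ h => hJ.mono h)
    (by
      intro I B hI hIm hB
      by_contra! hcon
      apply hIm
      have hBI : B ⊆ G.span I := by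
        intro b hb
        by_contra hbI
        exact hcon b ⟨hb, fun h => hbI (G.subset_span _ h)⟩ (hI.insert hbI)
      have huniv : ∀ x, x ∈ G.span I := by
        intro x
        apply span_le_span hBI
        by_contra hx
        exact hx (G.subset_span _ (hB.le_of_ge (hB.prop.insert hx) (Set.subset_insert _ _)
          (Set.mem_insert _ _)))
      refine ⟨hI, fun J hJ hIJ x hx => ?_⟩
      by_contra hxI
      refine hJ x hx (G.span_mono ?_ (huniv x))
      intro y hy
      exact ⟨hIJ hy, fun h => hxI (h ▸ hy)⟩)
    (by
      intro I h a ha hs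
      obtain ⟨F, hF, hFf, hx⟩ := span_finitary hs
      refine h (insert a F) ?_ (hFf.insert a) a (Set.mem_insert _ _) ?_
      · exact Set.insert_subset ha (fun y hy => (hF hy).1)
      · refine G.span_mono ?_ hx
        intro y hy
        exact ⟨Or.inr hy, (hF hy).2⟩)
    (fun I _ => Set.subset_univ I)).matroid

@[simp] theorem mat_E : G.mat.E = Set.univ := rfl
@[simp] theorem mat_indep {I : Set P} : G.mat.Indep I ↔ G.Indep I := Iff.rfl

theorem mat_closure (A : Set P) : G.mat.closure A = G.span A := by
  obtain ⟨I, hI⟩ := G.mat.exists_isBasis A (Set.subset_univ _)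
  have key : ∀ x, x ∈ G.mat.closure I ↔ x ∈ G.span I := by
    intro x
    by_cases hx : x ∈ I
    · exact iff_of_true (G.mat.mem_closure_of_mem hx (Set.subset_univ _)) (G.subset_span _ hx)
    · rw [hI.indep.mem_closure_iff_of_notMem hx, Matroid.dep_iff]
      simp only [mat_E, Set.subset_univ, and_true, mat_indep]
      constructor
      · intro h; by_contra h2; exact h (Indep.insert hI.indep h2)
      · intro h h2
        refine h2 x (Set.mem_insert _ _) (G.span_mono ?_ h)
        intro y hy
        exact ⟨Or.inr hy, fun h => hx (h ▸ hy)⟩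
  have key' : G.mat.closure I = G.span I := Set.ext key
  rw [← hI.closure_eq_closure, key']
  apply Set.Subset.antisymm (G.span_mono hI.subset)
  apply span_le_span
  rw [← key']
  exact hI.subset_closure

theorem rank_eq {A : Set P} (hA : A.Finite) : (G.rank A : ℕ∞) = G.mat.eRk A := by
  obtain ⟨I, hI⟩ := G.mat.exists_isBasis A (Set.subset_univ _)
  have hIf := hA.subset hI.subset
  rw [hI.eRk_eq_encard, ← hIf.cast_ncard_eq]
  congr 1
  apply IsGreatest.csSup_eq
  constructor
  · exact ⟨hIf.toFinset, by simpa using hI.subset, by simpa using hI.indep,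
      (Set.ncard_eq_toFinset_card I hIf).symm⟩
  · rintro n ⟨B, hB, hBi, rfl⟩
    have := Matroid.Indep.encard_le_eRk_of_subset (M := G.mat) hBi hB
    rw [hI.eRk_eq_encard, ← hIf.cast_ncard_eq, Set.encard_coe_eq_coe_finsetCard] at this
    exact_mod_cast this

theorem rank_le_ncard {A : Set P} (hA : A.Finite) : G.rank A ≤ A.ncard := by
  have := G.mat.eRk_le_encard A
  rw [← G.rank_eq hA, ← hA.cast_ncard_eq] at this
  exact_mod_cast this

variable {G} in
theorem rank_le_of_subset_span {A B : Set P} (hA : A.Finite) (hB : B.Finite)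
    (h : A ⊆ G.span B) : G.rank A ≤ G.rank B := by
  have := G.mat.eRk_mono h
  rw [← G.mat_closure, Matroid.eRk_closure_eq, ← G.rank_eq hA, ← G.rank_eq hB] at this
  exact_mod_cast this

theorem rank_union_le {A B : Set P} (hA : A.Finite) (hB : B.Finite) :
    G.rank (A ∪ B) ≤ G.rank A + B.ncard := by
  have := G.mat.eRk_union_le_eRk_add_encard A B
  rw [← G.rank_eq hA, ← G.rank_eq (hA.union hB), ← hB.cast_ncard_eq] at this
  exact_mod_cast this

theorem rank_submod {A B C : Set P} (hA : A.Finite) (hB : B.Finite) (hCA : C ⊆ A) (hCB : C ⊆ B) :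
    G.rank (A ∪ B) + G.rank C ≤ G.rank A + G.rank B := by
  have := G.mat.eRk_submod A B
  have h2 := G.mat.eRk_mono (Set.subset_inter hCA hCB)
  rw [← G.rank_eq hA, ← G.rank_eq (hA.union hB), ← G.rank_eq hB,
    ← G.rank_eq (hA.inter_of_left B)] at this
  rw [← G.rank_eq (hA.inter_of_left B), ← G.rank_eq (hA.subset hCA)] at h2
  have h3 : G.rank (A ∩ B) + G.rank (A ∪ B) ≤ G.rank A + G.rank B := by exact_mod_cast this
  have h4 : G.rank C ≤ G.rank (A ∩ B) := by exact_mod_cast h2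
  omega

theorem rank_insert {A : Set P} (hA : A.Finite) {p : P} (hp : p ∉ G.span A) :
    G.rank (insert p A) = G.rank A + 1 := by
  rw [← mat_closure] at hp
  have := G.mat.eRk_insert_eq_add_one (e := p) (X := A) ⟨Set.mem_univ _, hp⟩
  rw [← G.rank_eq hA, ← G.rank_eq (hA.insert p)] at this
  exact_mod_cast this

theorem rank_indep {A : Set P} (hA : A.Finite) (h : G.Indep A) : G.rank A = A.ncard := by
  have := Matroid.Indep.eRk_eq_encard (M := G.mat) h
  rw [← G.rank_eq hA, ← hA.cast_ncard_eq] at this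
  exact_mod_cast this

end ProjGeom
namespace MGraph

theorem rtg_mono {α : Type*} {r s : α → α → Prop} (h : ∀ a b, r a b → s a b) {a b : α}
    (hab : Relation.ReflTransGen r a b) : Relation.ReflTransGen s a b := by
  induction hab with
  | refl => exact Relation.ReflTransGen.refl
  | tail _ h2 ih => exact ih.tail (h _ _ h2)

variable {N E : Type*} (Γ : MGraph N E)

theorem adjIn_symm {S : Set E} {u v : N} (h : Γ.adjIn S u v) : Γ.adjIn S v u := by
  obtain ⟨e, he, h1, h2⟩ := h
  exact ⟨e, he, h2, h1⟩

variable {Γ} in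
theorem nodeConn.symm {S : Set E} {u v : N} (h : Γ.nodeConn S u v) : Γ.nodeConn S v u := by
  induction h with
  | refl => exact Relation.ReflTransGen.refl
  | tail _ h2 ih => exact Relation.ReflTransGen.head (Γ.adjIn_symm h2) ih

variable {Γ} in
theorem nodeConn.trans {S : Set E} {u v w : N} (h : Γ.nodeConn S u v) (h' : Γ.nodeConn S v w) :
    Γ.nodeConn S u w := Relation.ReflTransGen.trans h h'

variable {Γ} in
theorem nodeConn.mono {S T : Set E} (hST : S ⊆ T) {u v : N} (h : Γ.nodeConn S u v) :
    Γ.nodeConn T u v :=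
  rtg_mono (fun _ _ ⟨e, he, h⟩ => ⟨e, hST he, h⟩) h

theorem nodeConn_of_edge {S : Set E} {e : E} (he : e ∈ S) {u v : N} (hu : u ∈ Γ.ends e)
    (hv : v ∈ Γ.ends e) : Γ.nodeConn S u v := Relation.ReflTransGen.single ⟨e, he, hu, hv⟩

theorem mem_nodesOf {S : Finset E} {v : N} : v ∈ Γ.nodesOf S ↔ ∃ e ∈ S, v ∈ Γ.ends e := by
  simp [nodesOf]

theorem nodesOf_union (A B : Finset E) : Γ.nodesOf (A ∪ B) = Γ.nodesOf A ∪ Γ.nodesOf B := by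
  ext v; simp only [mem_nodesOf, Finset.mem_union]; grind

variable {Γ} in
theorem ConnEdges.nodeConn {S : Finset E} (h : Γ.ConnEdges ↑S) {u v : N}
    (hu : u ∈ Γ.nodesOf S) (hv : v ∈ Γ.nodesOf S) : Γ.nodeConn ↑S u v := by
  rw [mem_nodesOf] at hu hv
  obtain ⟨e, he, hue⟩ := hu
  obtain ⟨f, hf, hvf⟩ := hv
  have := h e he f hf
  clear hf
  induction this generalizing v with
  | refl => exact Γ.nodeConn_of_edge he hue hvf
  | tail _ h2 ih =>
    obtain ⟨ha, hb, w, hw1, hw2⟩ := h2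
    exact (ih hw1).trans (Γ.nodeConn_of_edge hb hw2 hvf)

variable {Γ} in
theorem ConnEdges.union {A B : Finset E} (hA : Γ.ConnEdges ↑A) (hB : Γ.ConnEdges ↑B) {v : N}
    (hvA : v ∈ Γ.nodesOf A) (hvB : v ∈ Γ.nodesOf B) : Γ.ConnEdges ↑(A ∪ B) := by
  rw [mem_nodesOf] at hvA hvB
  obtain ⟨a, ha, hva⟩ := hvA
  obtain ⟨b, hb, hvb⟩ := hvB
  have mA : ∀ e ∈ A, ∀ f ∈ A, Relation.ReflTransGen
    (fun a b => a ∈ (↑(A ∪ B) : Set E) ∧ b ∈ (↑(A ∪ B) : Set E) ∧ ∃ v : N, v ∈ Γ.ends a ∧ v ∈ Γ.ends b) e f :=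
    fun e he f hf => rtg_mono
      (fun x y ⟨h1, h2, h3⟩ => ⟨by simpa using Or.inl h1, by simpa using Or.inl h2, h3⟩) (hA e he f hf)
  have mB : ∀ e ∈ B, ∀ f ∈ B, Relation.ReflTransGen
    (fun a b => a ∈ (↑(A ∪ B) : Set E) ∧ b ∈ (↑(A ∪ B) : Set E) ∧ ∃ v : N, v ∈ Γ.ends a ∧ v ∈ Γ.ends b) e f :=
    fun e he f hf => rtg_mono
      (fun x y ⟨h1, h2, h3⟩ => ⟨by simpa using Or.inr h1, by simpa using Or.inr h2, h3⟩) (hB e he f hf)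
  have haU : a ∈ (↑(A ∪ B) : Set E) := by simp [ha]
  have hbU : b ∈ (↑(A ∪ B) : Set E) := by simp [hb]
  intro e he f hf
  simp only [Finset.coe_union, Set.mem_union, Finset.mem_coe] at he hf
  rcases he with he | he <;> rcases hf with hf | hf
  · exact mA e he f hf
  · exact ((mA e he a ha).tail ⟨haU, hbU, v, hva, hvb⟩).trans (mB b hb f hf)
  · exact ((mB e he b hb).tail ⟨hbU, haU, v, hvb, hva⟩).trans (mA a ha f hf)
  · exact mB e he f hf

theorem connEdges_singleton (e : E) : Γ.ConnEdges ↑({e} : Finset E) := by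
  intro a ha b hb
  simp only [Finset.coe_singleton, Set.mem_singleton_iff] at ha hb
  subst ha; subst hb
  exact Relation.ReflTransGen.refl

theorem degreeIn_union {A B : Finset E} (h : Disjoint A B) (v : N) :
    Γ.degreeIn (A ∪ B) v = Γ.degreeIn A v + Γ.degreeIn B v := by
  unfold degreeIn
  rw [Finset.filter_union, Finset.card_union_of_disjoint]
  exact Finset.disjoint_filter_filter h

theorem degreeIn_of_notMem {A : Finset E} {v : N} (h : v ∉ Γ.nodesOf A) : Γ.degreeIn A v = 0 := by
  unfold degreeIn
  rw [Finset.card_eq_zero, Finset.filter_eq_empty_iff]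
  intro e he hv
  exact h (Γ.mem_nodesOf.2 ⟨e, he, hv⟩)

theorem degreeIn_singleton (e : E) {v : N} (h : v ∈ Γ.ends e) : Γ.degreeIn {e} v = 1 := by
  unfold degreeIn
  rw [Finset.filter_singleton, if_pos h, Finset.card_singleton]

theorem nodesOf_singleton (e : E) : Γ.nodesOf {e} = Γ.ends e := by
  simp [nodesOf]

variable {Γ} in
theorem IsPath.union_circle {A B : Finset E} {u v : N} (hA : Γ.IsPath A u v) (hB : Γ.IsPath B u v)
    (hd : Disjoint A B) (hn : (↑(Γ.nodesOf A) ∩ ↑(Γ.nodesOf B) : Set N) = {u, v}) :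
    Γ.IsCircle (A ∪ B) := by
  obtain ⟨a1, a2, a3, a4, a5, a6, a7, a8, a9⟩ := hA
  obtain ⟨b1, b2, b3, b4, b5, b6, b7, b8, b9⟩ := hB
  refine ⟨a1.mono Finset.subset_union_left, ?_, a4.union b4 a5 b5, ?_⟩
  · intro e he
    rcases Finset.mem_union.1 he with h | h
    · exact a3 e h
    · exact b3 e h
  · intro w hw
    rw [degreeIn_union _ hd]
    by_cases hwu : w = u
    · subst hwu; rw [a7, b7]
    by_cases hwv : w = v
    · subst hwv; rw [a8, b8]
    have hnot : ¬ (w ∈ Γ.nodesOf A ∧ w ∈ Γ.nodesOf B) := by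
      intro h
      have : w ∈ (↑(Γ.nodesOf A) ∩ ↑(Γ.nodesOf B) : Set N) := h
      rw [hn] at this
      rcases this with h | h
      · exact hwu h
      · exact hwv h
    rw [nodesOf_union, Finset.mem_union] at hw
    by_cases hwA : w ∈ Γ.nodesOf A
    · rw [a9 w hwA hwu hwv, degreeIn_of_notMem _ (fun h => hnot ⟨hwA, h⟩)]
    · have hwB := hw.resolve_left hwA
      rw [b9 w hwB hwu hwv, degreeIn_of_notMem _ hwA]

theorem isPath_singleton {e : E} {u v : N} (huv : u ≠ v) (he : Γ.ends e = {u, v}) :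
    Γ.IsPath {e} u v := by
  have hu : u ∈ Γ.ends e := by simp [he]
  have hv : v ∈ Γ.ends e := by simp [he]
  refine ⟨by simp, huv, ?_, Γ.connEdges_singleton e, ?_, ?_, Γ.degreeIn_singleton e hu,
    Γ.degreeIn_singleton e hv, ?_⟩
  · intro f hf; rw [Finset.mem_singleton.1 hf, IsLink, he, Finset.card_pair huv]
  · simpa [nodesOf_singleton] using hu
  · simpa [nodesOf_singleton] using hv
  · intro w hw h1 h2
    rw [nodesOf_singleton, he] at hw
    simp at hw; tauto

variable {Γ} in
theorem IsPath.extend {Q : Finset E} {e : E} {x u v : N} (hQ : Γ.IsPath Q u v)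
    (he : Γ.ends e = {x, u}) (hx : x ∉ Γ.nodesOf Q) : Γ.IsPath ({e} ∪ Q) x v := by
  obtain ⟨a1, a2, a3, a4, a5, a6, a7, a8, a9⟩ := hQ
  have hxu : x ≠ u := fun h => hx (h ▸ a5)
  have hxv : x ≠ v := fun h => hx (h ▸ a6)
  have hxe : x ∈ Γ.ends e := by simp [he]
  have hue : u ∈ Γ.ends e := by simp [he]
  have heQ : Disjoint {e} Q := by
    rw [Finset.disjoint_singleton_left]
    exact fun h => hx (Γ.mem_nodesOf.2 ⟨e, h, hxe⟩)
  obtain ⟨_, _, b3, b4, b5, b6, b7, b8, b9⟩ := Γ.isPath_singleton hxu he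
  have hdeg : ∀ w, w ≠ x → w ≠ u → Γ.degreeIn {e} w = 0 := by
    intro w h1 h2
    apply degreeIn_of_notMem
    rw [nodesOf_singleton, he]; simp [h1, h2]
  refine ⟨⟨e, by simp⟩, hxv, ?_, b4.union a4 b6 a5, ?_, ?_, ?_, ?_, ?_⟩
  · intro f hf
    rcases Finset.mem_union.1 hf with h | h
    · exact b3 f h
    · exact a3 f h
  · rw [nodesOf_union]; exact Finset.mem_union_left _ b5
  · rw [nodesOf_union]; exact Finset.mem_union_right _ a6
  · rw [degreeIn_union _ heQ, b7, degreeIn_of_notMem _ hx]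
  · rw [degreeIn_union _ heQ, a8, hdeg v hxv.symm a2.symm]
  · intro w hw h1 h2
    rw [degreeIn_union _ heQ]
    by_cases hwu : w = u
    · subst hwu; rw [b8, a7]
    · rw [hdeg w h1 hwu]
      rw [nodesOf_union, Finset.mem_union, nodesOf_singleton, he] at hw
      have : w ∈ Γ.nodesOf Q := by
        rcases hw with h | h
        · simp at h; tauto
        · exact h
      rw [a9 w this hwu h2]

/-- the simple graph of adjacency through an edge set -/
def simp' (S : Set E) : SimpleGraph N where
  Adj u v := u ≠ v ∧ Γ.adjIn S u v
  symm := ⟨fun _ _ h => ⟨h.1.symm, Γ.adjIn_symm h.2⟩⟩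
  loopless := ⟨fun _ h => h.1 rfl⟩

variable {Γ} in
theorem nodeConn.reachable {S : Set E} {u v : N} (h : Γ.nodeConn S u v) :
    (Γ.simp' S).Reachable u v := by
  induction h with
  | refl => exact SimpleGraph.Reachable.refl _
  | @tail b c _ h2 ih =>
    by_cases hbc : b = c
    · exact hbc ▸ ih
    · exact ih.trans (SimpleGraph.Adj.reachable ⟨hbc, h2⟩)

theorem exists_path_of_walk (hcard : ∀ e, (Γ.ends e).card ≤ 2) {S : Set E} {u v : N}
    (p : (Γ.simp' S).Walk u v) (hp : p.IsPath)
    (huv : u ≠ v) : ∃ Q : Finset E, ↑Q ⊆ S ∧ Γ.IsPath Q u v ∧ ∀ w ∈ Γ.nodesOf Q, w ∈ p.support := by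
  have hends : ∀ e (x y : N), x ≠ y → x ∈ Γ.ends e → y ∈ Γ.ends e → Γ.ends e = {x, y} := by
    intro e x y hxy hx hy
    symm
    apply Finset.eq_of_subset_of_card_le
    · intro z hz; simp at hz; rcases hz with rfl | rfl <;> assumption
    · rw [Finset.card_pair hxy]; exact hcard e
  induction p with
  | nil => exact absurd rfl huv
  | @cons x y z h p ih =>
    rw [SimpleGraph.Walk.cons_isPath_iff] at hp
    have h0 := h
    obtain ⟨hxy, e, heS, hx, hy⟩ := h0
    have he := hends e x y hxy hx hy
    by_cases hyz : y = z
    · subst hyz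
      refine ⟨{e}, by simpa using heS, Γ.isPath_singleton hxy he, ?_⟩
      intro w hw
      rw [nodesOf_singleton, he] at hw
      simp at hw
      rcases hw with rfl | rfl <;> simp
    · obtain ⟨Q, hQS, hQ, hQn⟩ := ih hp.1 hyz
      refine ⟨{e} ∪ Q, ?_, hQ.extend he (fun h => hp.2 (hQn _ h)), ?_⟩
      · intro f hf
        simp only [Finset.coe_union, Finset.coe_singleton, Set.mem_union, Set.mem_singleton_iff, Finset.mem_coe] at hf
        rcases hf with rfl | hf
        · exact heS
        · exact hQS hf
      · intro w hw
        rw [nodesOf_union, Finset.mem_union, nodesOf_singleton, he] at hw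
        rw [SimpleGraph.Walk.support_cons, List.mem_cons]
        rcases hw with hw | hw
        · simp at hw
          rcases hw with rfl | rfl
          · simp
          · right; simp
        · right; exact hQn w hw

theorem exists_path (hcard : ∀ e, (Γ.ends e).card ≤ 2) {S : Set E} {u v : N}
    (h : Γ.nodeConn S u v) (huv : u ≠ v) : ∃ Q : Finset E, ↑Q ⊆ S ∧ Γ.IsPath Q u v := by
  obtain ⟨p, hp⟩ := h.reachable.exists_isPath
  obtain ⟨Q, h1, h2, _⟩ := Γ.exists_path_of_walk hcard p hp huv
  exact ⟨Q, h1, h2⟩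

/-- parent edges towards a root -/
theorem exists_parent {S : Set E} {v r : N}
    (h : Γ.nodeConn S v r) (hvr : v ≠ r) : ∃ e ∈ S, ∃ u, v ∈ Γ.ends e ∧ u ∈ Γ.ends e ∧
      Γ.nodeConn S u r ∧ (Γ.simp' S).dist u r < (Γ.simp' S).dist v r := by
  obtain ⟨p, hp⟩ := h.reachable.exists_walk_length_eq_dist
  cases p with
  | nil => exact absurd rfl hvr
  | cons h' p =>
    have h0 := h'
    obtain ⟨_, e, heS, hx, hy⟩ := h0
    refine ⟨e, heS, _, hx, hy, (Γ.nodeConn_of_edge heS hy hx).trans h, ?_⟩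
    have := SimpleGraph.dist_le p
    rw [← hp, SimpleGraph.Walk.length_cons]
    omega

end MGraph
namespace ProjGeom
variable {P : Type*} {G : ProjGeom P} {N E : Type*} {ν : N → P} {Γ : MGraph N E} {pt : E → P}

theorem indep_mem (hν : Function.Injective ν) (hind : G.Indep (Set.range ν)) {X : Set N} {w : N}
    (h : ν w ∈ G.span (ν '' X)) : w ∈ X := by
  by_contra hw
  refine hind (ν w) ⟨w, rfl⟩ (G.span_mono ?_ h)
  rintro _ ⟨x, hx, rfl⟩
  exact ⟨⟨x, rfl⟩, fun h => hw (hν h ▸ hx)⟩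

theorem IsCevian.card_le (hC : G.IsCevian ν Γ pt) (e : E) : (Γ.ends e).card ≤ 2 := by
  rcases hC e with ⟨v, w, hvw, he, _⟩ | ⟨v, he, _⟩
  · rw [he, Finset.card_pair hvw]
  · rw [he]; simp

theorem IsCevian.pt_mem (hC : G.IsCevian ν Γ pt) (e : E) {t : Set P} (ht : G.IsFlat t)
    (h : ∀ v ∈ Γ.ends e, ν v ∈ t) : pt e ∈ t := by
  rcases hC e with ⟨v, w, hvw, he, hl, _⟩ | ⟨v, he, hp⟩
  · exact ht _ (h v (by simp [he])) _ (h w (by simp [he])) hl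
  · rw [hp]; exact h v (by simp [he])

theorem IsCevian.step (hC : G.IsCevian ν Γ pt) {e : E} {t : Set P} (ht : G.IsFlat t)
    (het : pt e ∈ t) {u v : N} (hu : u ∈ Γ.ends e) (hv : v ∈ Γ.ends e) (hut : ν u ∈ t) :
    ν v ∈ t := by
  have aux : ∀ x y, pt e ∈ G.line (ν x) (ν y) → pt e ∉ Set.range ν → ν x ∈ t → ν y ∈ t := by
    intro x y hl hn hx
    apply ht _ het _ hx
    rw [G.line_eq hl (fun h => hn ⟨x, h.symm⟩)]
    exact G.right_mem_line _ _
  rcases hC e with ⟨x, y, hxy, he, hl, hn⟩ | ⟨x, he, hp⟩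
  · rw [he] at hu hv
    simp only [Finset.mem_insert, Finset.mem_singleton] at hu hv
    rcases hu with rfl | rfl <;> rcases hv with rfl | rfl
    · exact hut
    · exact aux _ _ hl hn hut
    · exact aux _ _ (G.line_symm _ _ ▸ hl) hn hut
    · exact hut
  · rw [he] at hu hv
    simp only [Finset.mem_singleton] at hu hv
    rw [hv, ← hu]; exact hut

theorem IsCevian.conn (hC : G.IsCevian ν Γ pt) {S : Set E} {t : Set P} (ht : G.IsFlat t)
    (hS : pt '' S ⊆ t) {u v : N} (h : Γ.nodeConn S u v) (hut : ν u ∈ t) : ν v ∈ t := by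
  induction h with
  | refl => exact hut
  | tail _ h2 ih =>
    obtain ⟨e, he, h1, h2⟩ := h2
    exact hC.step ht (hS ⟨e, he, rfl⟩) h1 h2 ih

theorem IsCevian.pts_sub (hC : G.IsCevian ν Γ pt) (S : Finset E) :
    pt '' ↑S ⊆ G.span (ν '' ↑(Γ.nodesOf S)) := by
  rintro _ ⟨e, he, rfl⟩
  apply hC.pt_mem e (G.span_isFlat _)
  intro v hv
  exact G.subset_span _ ⟨v, Γ.mem_nodesOf.2 ⟨e, he, hv⟩, rfl⟩

theorem IsCevian.mem_nodes (hC : G.IsCevian ν Γ pt) (hν : Function.Injective ν)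
    (hind : G.Indep (Set.range ν)) {S : Finset E} {w : N} (h : ν w ∈ G.span (pt '' ↑S)) :
    w ∈ Γ.nodesOf S :=
  indep_mem hν hind (span_le_span (hC.pts_sub S) h)

theorem rank_nodes (hν : Function.Injective ν)
    (hind : G.Indep (Set.range ν)) (X : Finset N) : G.rank (ν '' ↑X) = X.card := by
  rw [rank_indep _ (X.finite_toSet.image ν) (hind.mono (Set.image_subset_range _ _)),
    Set.ncard_image_of_injective _ hν, Set.ncard_coe_finset]

theorem fin_pts (S : Finset E) : (pt '' (↑S : Set E)).Finite := S.finite_toSet.image pt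

theorem IsCevian.nodes_sub (hC : G.IsCevian ν Γ pt) {S : Finset E} (hS : Γ.ConnEdges ↑S)
    {w : N} (hw : w ∈ Γ.nodesOf S) {t : Set P} (ht : G.IsFlat t)
    (hSt : pt '' ↑S ⊆ t) (hwt : ν w ∈ t) : ν '' ↑(Γ.nodesOf S) ⊆ t := by
  rintro _ ⟨v, hv, rfl⟩
  exact hC.conn ht hSt (hS.nodeConn hw hv) hwt

theorem IsCevian.card_le_rank_succ (hC : G.IsCevian ν Γ pt) (hν : Function.Injective ν)
    (hind : G.Indep (Set.range ν)) {S : Finset E} (hS : Γ.ConnEdges ↑S)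
    {w : N} (hw : w ∈ Γ.nodesOf S) : (Γ.nodesOf S).card ≤ G.rank (pt '' ↑S) + 1 := by
  rw [← rank_nodes hν hind]
  have h1 := G.rank_union_le (fin_pts (pt := pt) S) (Set.finite_singleton (ν w))
  rw [Set.ncard_singleton] at h1
  refine le_trans (rank_le_of_subset_span ((Finset.finite_toSet _).image _)
    ((fin_pts S).union (Set.finite_singleton (ν w))) ?_) h1
  apply hC.nodes_sub hS hw (G.span_isFlat _)
  · exact Set.subset_union_left.trans (G.subset_span _)
  · exact G.subset_span _ (Or.inr rfl)

theorem IsCevian.card_le_rank (hC : G.IsCevian ν Γ pt) (hν : Function.Injective ν)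
    (hind : G.Indep (Set.range ν)) {S : Finset E} (hS : Γ.ConnEdges ↑S)
    {w : N} (hw : w ∈ Γ.nodesOf S) (hws : ν w ∈ G.span (pt '' ↑S)) :
    (Γ.nodesOf S).card ≤ G.rank (pt '' ↑S) := by
  rw [← rank_nodes hν hind]
  refine rank_le_of_subset_span ((Finset.finite_toSet _).image _) (fin_pts S) ?_
  exact hC.nodes_sub hS hw (G.span_isFlat _) (G.subset_span _) hws

theorem IsCevian.rank_lt (hC : G.IsCevian ν Γ pt) (hν : Function.Injective ν)
    (hind : G.Indep (Set.range ν)) {S : Finset E}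
    {w : N} (hw : w ∈ Γ.nodesOf S) (hws : ν w ∉ G.span (pt '' ↑S)) :
    G.rank (pt '' ↑S) + 1 ≤ (Γ.nodesOf S).card := by
  rw [← rank_nodes hν hind, ← G.rank_insert (fin_pts S) hws]
  refine rank_le_of_subset_span ((fin_pts S).insert _) ((Finset.finite_toSet _).image _) ?_
  apply Set.insert_subset
  · exact G.subset_span _ ⟨w, hw, rfl⟩
  · exact hC.pts_sub S

/-- balanced circles -/
def cBal (G : ProjGeom P) (ν : N → P) (Γ : MGraph N E) (pt : E → P) : Set (Finset E) :=
  {C | Γ.IsCircle C ∧ ∃ t : Set P, G.crossFlat ν t ∧ ∀ e ∈ C, pt e ∈ t}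

theorem IsCevian.linear (hC : G.IsCevian ν Γ pt) (hν : Function.Injective ν)
    (hind : G.Indep (Set.range ν)) : Γ.IsLinearClass (cBal G ν Γ pt) := by
  refine ⟨fun C h => h.1, ?_⟩
  intro u v P₁ P₂ P₃ h1 h2 h3 d12 d13 d23 n12 n13 n23 b12 b13
  refine ⟨h2.union_circle h3 d23 n23, G.span (pt '' ↑((P₁ ∪ P₂) ∪ P₃)), ⟨G.span_isFlat _, ?_⟩, ?_⟩
  swap
  · intro e he
    apply G.subset_span
    refine ⟨e, ?_, rfl⟩
    simp only [Finset.coe_union, Set.mem_union, Finset.mem_coe, Finset.mem_union] at he ⊢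
    tauto
  have c1 := h1.2.2.2.1
  have hu1 := h1.2.2.2.2.1
  have c3 := h3.2.2.2.1
  have hu3 := h3.2.2.2.2.1
  have hu12 : u ∈ Γ.nodesOf (P₁ ∪ P₂) := by rw [Γ.nodesOf_union]; simp [hu1]
  have hu13 : u ∈ Γ.nodesOf (P₁ ∪ P₃) := by rw [Γ.nodesOf_union]; simp [hu1]
  have cT : Γ.ConnEdges ↑((P₁ ∪ P₂) ∪ P₃) := b12.1.2.2.1.union c3 hu12 hu3
  have key : ∀ C ∈ cBal G ν Γ pt, ∀ w, ν w ∉ G.span (pt '' ↑C) := by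
    rintro C ⟨_, t, ht, hCt⟩ w hw
    refine ht.2 w (span_le ht.1 ?_ hw)
    rintro _ ⟨e, he, rfl⟩
    exact hCt e he
  have r12 := hC.rank_lt hν hind hu12 (key _ b12 u)
  have r13 := hC.rank_lt hν hind hu13 (key _ b13 u)
  have r1 := hC.card_le_rank_succ hν hind c1 hu1
  have sub := G.rank_submod (A := pt '' ↑(P₁ ∪ P₂)) (B := pt '' ↑(P₁ ∪ P₃)) (C := pt '' ↑P₁)
    (fin_pts _) (fin_pts _) (Set.image_mono (by simp)) (Set.image_mono (by simp))
  have hun : pt '' ↑(P₁ ∪ P₂) ∪ pt '' ↑(P₁ ∪ P₃) = pt '' (↑((P₁ ∪ P₂) ∪ P₃) : Set E) := by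
    rw [← Set.image_union]; congr 1; ext x; simp; tauto
  rw [hun] at sub
  have huv := h1.2.1
  have i12 : Γ.nodesOf P₁ ∩ Γ.nodesOf P₂ = {u, v} := by
    apply Finset.coe_injective; push_cast; exact n12
  have i13 : Γ.nodesOf P₁ ∩ Γ.nodesOf P₃ = {u, v} := by
    apply Finset.coe_injective; push_cast; exact n13
  have i23 : Γ.nodesOf P₂ ∩ Γ.nodesOf P₃ = {u, v} := by
    apply Finset.coe_injective; push_cast; exact n23
  have k12 := Finset.card_union_add_card_inter (Γ.nodesOf P₁) (Γ.nodesOf P₂)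
  have k13 := Finset.card_union_add_card_inter (Γ.nodesOf P₁) (Γ.nodesOf P₃)
  have kT := Finset.card_union_add_card_inter (Γ.nodesOf P₁ ∪ Γ.nodesOf P₂) (Γ.nodesOf P₃)
  rw [Finset.union_inter_distrib_right, i13, i23, Finset.union_self, Finset.card_pair huv] at kT
  rw [i12, Finset.card_pair huv] at k12
  rw [i13, Finset.card_pair huv] at k13
  intro w hw
  have hwn := hC.mem_nodes hν hind hw
  have := hC.card_le_rank hν hind cT hwn hw
  simp only [Γ.nodesOf_union] at this r12 r13
  omega

/-- an edge closing a balanced circle is in the span of the rest -/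
theorem IsCevian.closes (hC : G.IsCevian ν Γ pt) {Q : Set E} {e : E} {u v : N}
    (he : Γ.ends e = {u, v}) (hQ : Γ.nodeConn Q u v) {t : Set P} (ht : G.IsFlat t)
    (hQt : pt '' Q ⊆ t) (het : pt e ∈ t) (hu : ν u ∉ t) : pt e ∈ G.span (pt '' Q) := by
  by_contra hcon
  apply hu
  have h1 : pt e ∈ G.span (insert (ν u) (pt '' Q)) := by
    have hus : ν u ∈ G.span (insert (ν u) (pt '' Q)) := G.subset_span _ (Set.mem_insert _ _)
    have hvs := hC.conn (G.span_isFlat _)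
      ((Set.subset_insert (ν u) (pt '' Q)).trans (G.subset_span _)) hQ hus
    apply hC.pt_mem e (G.span_isFlat _)
    intro w hw
    rw [he] at hw
    simp only [Finset.mem_insert, Finset.mem_singleton] at hw
    rcases hw with rfl | rfl
    · exact hus
    · exact hvs
  exact span_le ht (Set.insert_subset het hQt) (exchange h1 hcon)

theorem IsCevian.frame [Fintype N] (hC : G.IsCevian ν Γ pt) (hν : Function.Injective ν)
    (hind : G.Indep (Set.range ν)) (S : Finset E) :
    Γ.frameRk (cBal G ν Γ pt) ↑S = G.rank (pt '' (↑S : Set E)) := by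
  set B := cBal G ν Γ pt with hB
  let comp : N → Set N := fun v => {u | Γ.nodeConn (↑S : Set E) u v}
  let bal : N → Prop := fun v => Γ.IsBalancedSet B (Γ.edgesIn (↑S : Set E) (comp v))
  have comp_eq : ∀ {u v}, Γ.nodeConn (↑S : Set E) u v → comp u = comp v := by
    intro u v h
    ext x
    exact ⟨fun hx => MGraph.nodeConn.trans hx h, fun hx => MGraph.nodeConn.trans hx h.symm⟩
  have crefl : ∀ v, Γ.nodeConn (↑S : Set E) v v := fun v => Relation.ReflTransGen.refl
  let BK : Set (Set N) := {W : Set N | W ∈ Γ.components (↑S : Set E) ∧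
    Γ.IsBalancedSet B (Γ.edgesIn (↑S : Set E) W)}
  have hr : ∀ W : ↥BK, ∃ v : N, W.1 = comp v := fun W => W.2.1
  choose r hr using hr
  have hrinj : Function.Injective r := by
    intro W W' h
    apply Subtype.ext
    rw [hr, hr, h]
  let R : Set N := Set.range r
  have hRcard : R.ncard = Γ.numBalComponents B ↑S := by
    unfold MGraph.numBalComponents
    rw [← Nat.card_coe_set_eq]
    exact Nat.card_congr (Equiv.ofInjective r hrinj).symm
  have hRbal : ∀ v ∈ R, bal v := by
    rintro _ ⟨W, rfl⟩
    have := W.2.2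
    rw [hr W] at this
    exact this
  have hroot : ∀ v, bal v → ∃ w ∈ R, Γ.nodeConn (↑S : Set E) v w := by
    intro v hv
    let W : ↥BK := ⟨comp v, ⟨v, rfl⟩, hv⟩
    refine ⟨r W, ⟨W, rfl⟩, ?_⟩
    have h := hr W
    have : v ∈ W.1 := crefl v
    rw [h] at this
    exact this
  have hrootuniq : ∀ v ∈ R, ∀ w ∈ R, Γ.nodeConn (↑S : Set E) v w → v = w := by
    rintro _ ⟨W, rfl⟩ _ ⟨W', rfl⟩ h
    have : W = W' := Subtype.ext (by rw [hr W, hr W', comp_eq h])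
    rw [this]
  have balcongr : ∀ {u v}, Γ.nodeConn (↑S : Set E) u v → bal u → bal v := by
    intro u v h hu
    show Γ.IsBalancedSet B (Γ.edgesIn (↑S : Set E) (comp v))
    rw [← comp_eq h]; exact hu
  have hRle : R.ncard ≤ Fintype.card N := by
    rw [← Nat.card_eq_fintype_card, ← Set.ncard_univ]
    exact Set.ncard_le_ncard (Set.subset_univ R) Set.finite_univ
  -- lower bound
  have lower : Fintype.card N ≤ G.rank (pt '' (↑S : Set E)) + R.ncard := by
    have h1 : G.rank (Set.range ν) = Fintype.card N := by
      rw [← Set.image_univ, ← Finset.coe_univ, rank_nodes hν hind, Finset.card_univ]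
    rw [← h1, ← Set.ncard_image_of_injective R hν]
    refine le_trans (rank_le_of_subset_span (Set.finite_range ν)
      ((fin_pts S).union (Set.toFinite (ν '' R))) ?_) (G.rank_union_le (fin_pts S) (Set.toFinite _))
    rintro _ ⟨v, rfl⟩
    have hsub : pt '' (↑S : Set E) ⊆ G.span (pt '' (↑S : Set E) ∪ ν '' R) :=
      Set.subset_union_left.trans (G.subset_span _)
    have main : ∃ w, Γ.nodeConn (↑S : Set E) w v ∧ ν w ∈ G.span (pt '' (↑S : Set E) ∪ ν '' R) := by
      by_cases hv : bal v
      · obtain ⟨w, hw, hvw⟩ := hroot v hv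
        exact ⟨w, hvw.symm, G.subset_span _ (Or.inr ⟨w, hw, rfl⟩)⟩
      · have hv' : ¬ ((∀ e ∈ Γ.edgesIn (↑S : Set E) (comp v), Γ.IsLink e) ∧ ∀ C : Finset E,
          ↑C ⊆ Γ.edgesIn (↑S : Set E) (comp v) → Γ.IsCircle C → C ∈ B) := hv
        rw [not_and_or] at hv'
        rcases hv' with h | h
        · push Not at h
          obtain ⟨e, he, hl⟩ := h
          rcases hC e with ⟨x, y, hxy, hee, _⟩ | ⟨x, hee, hp⟩
          · exact absurd (by rw [MGraph.IsLink, hee, Finset.card_pair hxy]) hl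
          · refine ⟨x, he.2 x (by simp [hee]), ?_⟩
            rw [← hp]
            exact hsub ⟨e, he.1, rfl⟩
        · push Not at h
          obtain ⟨C, hCS, hCc, hCB⟩ := h
          have : ∃ w, ν w ∈ G.span (pt '' (↑C : Set E)) := by
            by_contra! hcon
            exact hCB ⟨hCc, _, ⟨G.span_isFlat _, hcon⟩, fun e he => G.subset_span _ ⟨e, he, rfl⟩⟩
          obtain ⟨w, hw⟩ := this
          obtain ⟨e, he, hwe⟩ := Γ.mem_nodesOf.1 (hC.mem_nodes hν hind hw)
          refine ⟨w, (hCS he).2 w hwe, ?_⟩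
          refine span_le_span ?_ hw
          refine Set.Subset.trans (Set.image_mono ?_) hsub
          exact fun e he => (hCS he).1
    obtain ⟨w, hwv, hw⟩ := main
    exact hC.conn (G.span_isFlat _) hsub hwv hw
  -- upper bound
  have upper : G.rank (pt '' (↑S : Set E)) + R.ncard ≤ Fintype.card N := by
    have hpar : ∀ v, ∃ p : P, (¬ bal v → p = ν v) ∧ (bal v → v ∉ R → ∃ e ∈ S, p = pt e ∧
        ∃ u, v ∈ Γ.ends e ∧ u ∈ Γ.ends e ∧ ∃ w ∈ R, Γ.nodeConn (↑S : Set E) v w ∧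
          Γ.nodeConn (↑S : Set E) u w ∧
          (Γ.simp' (↑S : Set E)).dist u w < (Γ.simp' (↑S : Set E)).dist v w) := by
      intro v
      by_cases hv : bal v
      · by_cases hvR : v ∈ R
        · exact ⟨ν v, fun h => absurd hv h, fun _ h => absurd hvR h⟩
        · obtain ⟨w, hw, hvw⟩ := hroot v hv
          obtain ⟨e, heS, u, hve, hue, huw, hd⟩ :=
            Γ.exists_parent hvw (fun h => hvR (h ▸ hw))
          exact ⟨pt e, fun h => absurd hv h, fun _ _ => ⟨e, heS, rfl, u, hve, hue, w, hw, hvw, huw, hd⟩⟩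
      · exact ⟨ν v, fun _ => rfl, fun h => absurd h hv⟩
    choose g hg1 hg2 using hpar
    let Z : Set P := g '' Rᶜ
    have hZf : Z.Finite := Set.toFinite _
    have hZ : Z.ncard + R.ncard ≤ Fintype.card N := by
      have h1 : Z.ncard ≤ Rᶜ.ncard := Set.ncard_image_le (Set.toFinite _)
      have h2 := Set.ncard_add_ncard_compl R
      rw [Nat.card_eq_fintype_card] at h2
      omega
    -- the tree edges
    let T : Set E := {e | e ∈ S ∧ pt e ∈ G.span Z}
    have hTS : T ⊆ ↑S := fun e he => he.1
    have hTZ : pt '' T ⊆ G.span Z := by rintro _ ⟨e, he, rfl⟩; exact he.2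
    have hTconn : ∀ n : ℕ, ∀ v w, bal v → w ∈ R → Γ.nodeConn (↑S : Set E) v w →
        (Γ.simp' (↑S : Set E)).dist v w = n → Γ.nodeConn T v w := by
      intro n
      induction n using Nat.strong_induction_on with
      | _ n ih =>
        intro v w hv hw hvw hd
        by_cases hvR : v ∈ R
        · rw [hrootuniq v hvR w hw hvw]; exact Relation.ReflTransGen.refl
        · obtain ⟨e, heS, hp, u, hve, hue, w', hw', hvw', huw', hlt⟩ := hg2 v hv hvR
          have : w' = w := hrootuniq w' hw' w hw (hvw'.symm.trans hvw)
          subst this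
          have heT : e ∈ T := ⟨heS, by rw [← hp]; exact G.subset_span _ ⟨v, hvR, rfl⟩⟩
          refine (Γ.nodeConn_of_edge heT hve hue).trans ?_
          exact ih _ (hd ▸ hlt) u w' (balcongr (hvw'.trans huw'.symm) hv) hw' huw' rfl
    have hTconn2 : ∀ u v, bal u → Γ.nodeConn (↑S : Set E) u v → Γ.nodeConn T u v := by
      intro u v hu huv
      obtain ⟨w, hw, huw⟩ := hroot u hu
      exact (hTconn _ u w hu hw huw rfl).trans
        (hTconn _ v w (balcongr huv hu) hw (huv.symm.trans huw) rfl).symm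
    have hsub : pt '' (↑S : Set E) ⊆ G.span Z := by
      rintro _ ⟨e, he, rfl⟩
      by_cases hex : ∃ u ∈ Γ.ends e, bal u
      · obtain ⟨u, hu, hbu⟩ := hex
        have hin : ∀ w ∈ Γ.ends e, w ∈ comp u := fun w hw => Γ.nodeConn_of_edge he hw hu
        have hlink : (Γ.ends e).card = 2 := hbu.1 e ⟨he, hin⟩
        obtain ⟨v, huv, hee⟩ : ∃ v, u ≠ v ∧ Γ.ends e = {u, v} := by
          obtain ⟨x, y, hxy, hxe⟩ := Finset.card_eq_two.1 hlink
          rw [hxe] at hu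
          simp only [Finset.mem_insert, Finset.mem_singleton] at hu
          rcases hu with rfl | rfl
          · exact ⟨y, hxy, hxe⟩
          · exact ⟨x, hxy.symm, by rw [hxe, Finset.pair_comm]⟩
        have hve : v ∈ Γ.ends e := by simp [hee]
        by_cases heT : e ∈ T
        · exact heT.2
        obtain ⟨Q, hQT, hQ⟩ := Γ.exists_path hC.card_le
          (hTconn2 u v hbu (Γ.nodeConn_of_edge he hu hve)) huv
        have hQc := hQ.2.2.2.1
        have huQ := hQ.2.2.2.2.1
        have hvQ := hQ.2.2.2.2.2.1
        have hcirc : Γ.IsCircle ({e} ∪ Q) := by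
          apply (Γ.isPath_singleton huv hee).union_circle hQ
          · rw [Finset.disjoint_singleton_left]; exact fun h => heT (hQT h)
          · rw [Γ.nodesOf_singleton, hee]
            ext x
            simp only [Finset.coe_insert, Finset.coe_singleton, Set.mem_inter_iff,
              Set.mem_insert_iff, Set.mem_singleton_iff, Finset.mem_coe]
            constructor
            · exact fun h => h.1
            · rintro (rfl | rfl)
              · exact ⟨Or.inl rfl, huQ⟩
              · exact ⟨Or.inr rfl, hvQ⟩
        have hmem : ({e} ∪ Q) ∈ B := by
          apply hbu.2 _ _ hcirc
          intro f hf
          simp only [Finset.coe_union, Finset.coe_singleton, Set.mem_union,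
            Set.mem_singleton_iff, Finset.mem_coe] at hf
          rcases hf with rfl | hf
          · exact ⟨he, hin⟩
          · refine ⟨hTS (hQT hf), fun w hw => ?_⟩
            exact MGraph.nodeConn.mono (hQT.trans hTS)
              (hQc.nodeConn (Γ.mem_nodesOf.2 ⟨f, hf, hw⟩) huQ)
        obtain ⟨_, t, ht, hCt⟩ := hmem
        have := hC.closes hee (hQc.nodeConn huQ hvQ) ht.1
          (by rintro _ ⟨f, hf, rfl⟩; exact hCt f (Finset.mem_union_right _ hf))
          (hCt e (by simp)) (ht.2 u)
        exact span_le_span ((Set.image_mono hQT).trans hTZ) this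
      · push Not at hex
        apply hC.pt_mem e (G.span_isFlat _)
        intro v hv
        apply G.subset_span
        exact ⟨v, fun h => hex v hv (hRbal v h), hg1 v (hex v hv)⟩
    have := rank_le_of_subset_span (fin_pts S) hZf hsub
    have := G.rank_le_ncard hZf
    omega
  unfold MGraph.frameRk
  rw [← hRcard]
  omega

theorem men_cevian (Ehat : Set P)
    (hE : ∀ x ∈ Ehat, x ∉ Set.range ν →
      ∃ pr : N × N, pr.1 ≠ pr.2 ∧ x ∈ G.line (ν pr.1) (ν pr.2)) :
    G.IsCevian ν (G.menGraph ν Ehat hE) Subtype.val := by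
  intro e
  by_cases h : (e : P) ∈ Set.range ν
  · right
    refine ⟨(show ∃ v : N, ν v = ↑e from h).choose, ?_, ?_⟩
    · simp only [menGraph, dif_pos h]
    · exact (show ∃ v : N, ν v = ↑e from h).choose_spec.symm
  · left
    refine ⟨_, _, (hE e e.2 h).choose_spec.1, ?_, (hE e e.2 h).choose_spec.2, h⟩
    simp only [menGraph, dif_neg h]

end ProjGeom

/-! ## Statement 3 -/

/-- Let `N̂ = ν(N)` be an independent set of points in a
projective geometry and let `Ehat ⊆ Ê^•(N̂)` (every point of `Ehat` is a basis
point or lies on an edge line).  Then the class of balanced circles of the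
constructed graph is a linear class, so `Ω(N̂, Ehat)` is a biased graph, and the
natural correspondence `e ↦ ê` is a matroid isomorphism from the frame matroid
`G(Ω(N̂, Ehat))` onto the matroid `M(Ehat)` of projective dependence of `Ehat`
(an injective, rank-preserving correspondence). -/
theorem stmt3 {P N : Type*} [Fintype N] (G : ProjGeom P) (ν : N → P)
    (hν : Function.Injective ν) (hind : G.Indep (Set.range ν))
    (Ehat : Set P)
    (hE : ∀ x ∈ Ehat, x ∉ Set.range ν →
      ∃ pr : N × N, pr.1 ≠ pr.2 ∧ x ∈ G.line (ν pr.1) (ν pr.2)) :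
    (G.menGraph ν Ehat hE).IsLinearClass (G.menBal ν Ehat hE) ∧
    ∀ S : Finset ↥Ehat,
      (G.menGraph ν Ehat hE).frameRk (G.menBal ν Ehat hE) ↑S
        = G.rank (Subtype.val '' (↑S : Set ↥Ehat)) := by
  have hC := ProjGeom.men_cevian (G := G) (ν := ν) Ehat hE
  exact ⟨hC.linear hν hind, fun S => hC.frame hν hind S⟩
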